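/- Enumeration corollary: W(P) = H_n if and only if there exist B ∈ GL_n(F_2) and Q_1, ..., Q_n ∈ GL_{n-1}(F_2) such that P_0 = B·diag(Q_1, 1), P_i = diag(Q_i^{-1}, 1)·C_n·diag(Q_{i+1}, 1) for 0 < i < n, and P_n = diag(Q_n^{-1}, 1)·C_n·B^T, where diag(Q, 1) denotes the block-diagonal n×n matrix with block Q and a 1 in the bottom-right corner, and C_n is the cyclic bit-rotation matrix. -/

import Mathlib

open Matrix

/-- Binary representation of `i` as a vector in `F_2^n`, most significant bit first. -/
def bits (n : ℕ) (i : Fin (2 ^ n)) : Fin n → ZMod 2 :=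
  fun k => if Nat.testBit i.val (n - 1 - k.val) then 1 else 0

/-- The vector `1_b = (0,...,0,1)ᵀ`. -/
def oneb (n : ℕ) : Fin n → ZMod 2 := fun k => if k.val = n - 1 then 1 else 0

/-- Permutation matrix `P(Q)` of the linear permutation `π(Q)`:
entry `(j, i)` is `1` iff `j_b = Q i_b`. -/
def permMat (n : ℕ) (Q : Matrix (Fin n) (Fin n) (ZMod 2)) :
    Matrix (Fin (2 ^ n)) (Fin (2 ^ n)) ℤ :=
  Matrix.of fun j i => if bits n j = Q.mulVec (bits n i) then 1 else 0

/-- The array of butterflies `I_{2^{n-1}} ⊗ DFT_2`. -/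
def butterflies (n : ℕ) : Matrix (Fin (2 ^ n)) (Fin (2 ^ n)) ℤ :=
  Matrix.of fun j i =>
    if j.val / 2 = i.val / 2 then (if j.val % 2 = 1 ∧ i.val % 2 = 1 then -1 else 1) else 0

/-- `W(P) = P(P₀)·(I ⊗ DFT₂)·P(P₁) ⋯ (I ⊗ DFT₂)·P(Pₙ)`. -/
def W (n : ℕ) (P : ℕ → Matrix (Fin n) (Fin n) (ZMod 2)) :
    Matrix (Fin (2 ^ n)) (Fin (2 ^ n)) ℤ :=
  permMat n (P 0) * (List.ofFn fun k : Fin n => butterflies n * permMat n (P (k.val + 1))).prod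

/-- `P_{i:j} = P_i P_{i+1} ⋯ P_j` (identity if `j < i`). -/
def Pseg {n : ℕ} (P : ℕ → Matrix (Fin n) (Fin n) (ZMod 2)) (i j : ℕ) :
    Matrix (Fin n) (Fin n) (ZMod 2) :=
  ((List.range (j + 1 - i)).map fun k => P (i + k)).prod

/-- The spreading matrix `X = (P_{0:n-1}1_b | P_{0:n-2}1_b | ⋯ | P_0 1_b)`. -/
def spread (n : ℕ) (P : ℕ → Matrix (Fin n) (Fin n) (ZMod 2)) :
    Matrix (Fin n) (Fin n) (ZMod 2) :=
  Matrix.of fun r c => (Pseg P 0 (n - 1 - c.val)).mulVec (oneb n) r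

/-- The matrix whose rows are `(P_{0:n-1}^{-T}1_b)ᵀ, ..., (P_0^{-T}1_b)ᵀ`. -/
noncomputable def spreadInvRows (n : ℕ) (P : ℕ → Matrix (Fin n) (Fin n) (ZMod 2)) :
    Matrix (Fin n) (Fin n) (ZMod 2) :=
  Matrix.of fun r c => (Pseg P 0 (n - 1 - r.val))⁻¹.transpose.mulVec (oneb n) c

/-- The Hadamard matrix `H_n` with entries `(-1)^{⟨i_b, j_b⟩}`. -/
def hadamardH (n : ℕ) : Matrix (Fin (2 ^ n)) (Fin (2 ^ n)) ℤ :=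
  Matrix.of fun i j => (-1) ^ (∑ k, bits n i k * bits n j k).val

/-- The cyclic bit-rotation matrix `C_n`: ones on the superdiagonal and in the
bottom-left corner. -/
def Cmat (n : ℕ) : Matrix (Fin n) (Fin n) (ZMod 2) :=
  Matrix.of fun k l => if l.val = k.val + 1 ∨ (k.val = n - 1 ∧ l.val = 0) then 1 else 0

/-- `diag(Q, 1)`: block-diagonal matrix with block `Q` and a `1` in the
bottom-right corner. -/
def diagOne (m : ℕ) (Q : Matrix (Fin m) (Fin m) (ZMod 2)) :
    Matrix (Fin (m + 1)) (Fin (m + 1)) (ZMod 2) :=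
  Matrix.reindex finSumFinEquiv finSumFinEquiv (Matrix.fromBlocks Q 0 0 1)


/-- The sign character `F_2 → {1, -1}`. -/
def signChar (a : ZMod 2) : ℤ := (-1) ^ a.val

lemma signChar_add (a b : ZMod 2) : signChar (a + b) = signChar a * signChar b := by
  revert a b; decide

lemma signChar_injective : Function.Injective signChar := by
  unfold Function.Injective; decide

lemma signChar_ne_zero (a : ZMod 2) : signChar a ≠ 0 := by
  revert a; decide

lemma bits_injective (n : ℕ) : Function.Injective (bits n) := by
  intro i j h
  apply Fin.ext
  apply Nat.eq_of_testBit_eq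
  intro t
  by_cases ht : t < n
  · have := congrFun h ⟨n - 1 - t, by omega⟩
    simp only [bits] at this
    rw [show n - 1 - (n - 1 - t) = t by omega] at this
    revert this
    cases Nat.testBit i.val t <;> cases Nat.testBit j.val t <;> simp
  · have hle : 2 ^ n ≤ 2 ^ t := Nat.pow_le_pow_right (by norm_num) (by omega)
    rw [Nat.testBit_lt_two_pow (lt_of_lt_of_le i.2 hle),
      Nat.testBit_lt_two_pow (lt_of_lt_of_le j.2 hle)]

lemma bits_bijective (n : ℕ) : Function.Bijective (bits n) := by
  rw [Fintype.bijective_iff_injective_and_card]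
  exact ⟨bits_injective n, by simp⟩

lemma oneb_succ (m : ℕ) : oneb (m + 1) = Pi.single (Fin.last m) 1 := by
  funext k
  simp [oneb, Pi.single_apply, Fin.ext_iff]

lemma bits_last (m : ℕ) (i : Fin (2 ^ (m + 1))) :
    bits (m + 1) i (Fin.last m) = if i.val % 2 = 1 then 1 else 0 := by
  simp [bits, Nat.testBit_zero]

lemma div_two_eq_iff_bits (m : ℕ) (i j : Fin (2 ^ (m + 1))) :
    j.val / 2 = i.val / 2 ↔
      ∀ k : Fin (m + 1), k ≠ Fin.last m → bits (m + 1) j k = bits (m + 1) i k := by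
  constructor
  · intro h k hk
    have hk' : k.val < m := Fin.val_lt_last hk
    simp only [bits]
    rw [show m + 1 - 1 - k.val = (m - 1 - k.val) + 1 by omega, Nat.testBit_succ,
      Nat.testBit_succ, h]
  · intro h
    have hlt : ∀ i : Fin (2 ^ (m + 1)), i.val / 2 < 2 ^ m := fun i => by
      have := i.2; have h2 := pow_succ 2 m; omega
    have := @bits_injective m ⟨_, hlt j⟩ ⟨_, hlt i⟩ (by
      funext k
      have := h k.castSucc (Fin.castSucc_lt_last k).ne
      have hk : m + 1 - 1 - k.castSucc.val = (m - 1 - k.val) + 1 := by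
        have := k.2; simp only [Fin.val_castSucc]; omega
      simpa only [bits, hk, Nat.testBit_succ] using this)
    simpa using this

/-- The butterfly array connects `y` with `y` and `y + 1_b`. -/
lemma butterflies_apply (m : ℕ) (j i : Fin (2 ^ (m + 1))) :
    butterflies (m + 1) j i = ∑ c : ZMod 2,
      if bits (m + 1) j = bits (m + 1) i + c • oneb (m + 1) then
        signChar (bits (m + 1) j (Fin.last m) * bits (m + 1) i (Fin.last m)) else 0 := by
  have key : j.val / 2 = i.val / 2 ↔ bits (m + 1) j = bits (m + 1) i +
      (bits (m + 1) j (Fin.last m) - bits (m + 1) i (Fin.last m)) • oneb (m + 1) := by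
    rw [div_two_eq_iff_bits, funext_iff]
    refine forall_congr' fun k => ?_
    by_cases hk : k = Fin.last m
    · subst hk; simp [oneb_succ]
    · simp [oneb_succ, hk]
  rw [Finset.sum_eq_single (bits (m + 1) j (Fin.last m) - bits (m + 1) i (Fin.last m))]
  · simp only [butterflies, Matrix.of_apply, ← key]
    split_ifs with h1 h2
    · rw [bits_last, bits_last, if_pos h2.1, if_pos h2.2]; decide
    · rw [bits_last, bits_last]
      split_ifs with h3 h4 <;> first | decide | exact absurd ⟨h3, h4⟩ h2
    · rfl
  · intro c _ hc
    rw [if_neg]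
    intro h
    apply hc
    have := congrFun h (Fin.last m)
    simp only [oneb_succ, Pi.add_apply, Pi.smul_apply, Pi.single_eq_same, smul_eq_mul,
      mul_one] at this
    rw [this]; ring
  · simp

lemma mul_permMat_apply {n : ℕ} (M : Matrix (Fin (2 ^ n)) (Fin (2 ^ n)) ℤ)
    (Q : Matrix (Fin n) (Fin n) (ZMod 2)) (j i i' : Fin (2 ^ n))
    (h : bits n i' = Q.mulVec (bits n i)) : (M * permMat n Q) j i = M j i' := by
  rw [Matrix.mul_apply, Finset.sum_eq_single i']
  · simp [permMat, h]
  · intro b _ hb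
    simp only [permMat, Matrix.of_apply, ← h]
    rw [if_neg fun h' => hb (bits_injective n h'), mul_zero]
  · simp

/-- The prefix product `P_0 P_1 ⋯ P_k`. -/
def prefixProd {n : ℕ} (P : ℕ → Matrix (Fin n) (Fin n) (ZMod 2)) :
    ℕ → Matrix (Fin n) (Fin n) (ZMod 2)
  | 0 => P 0
  | k + 1 => prefixProd P k * P (k + 1)

lemma isUnit_prefixProd {n : ℕ} {P : ℕ → Matrix (Fin n) (Fin n) (ZMod 2)} :
    ∀ {k : ℕ}, (∀ l ≤ k, IsUnit (P l)) → IsUnit (prefixProd P k)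
  | 0, h => h 0 le_rfl
  | k + 1, h => (isUnit_prefixProd fun l hl => h l (hl.trans k.le_succ)).mul (h _ le_rfl)

/-- Direction in which the `k`-th array of butterflies spreads. -/
def dirVec {m : ℕ} (P : ℕ → Matrix (Fin (m + 1)) (Fin (m + 1)) (ZMod 2)) (k : ℕ) :
    Fin (m + 1) → ZMod 2 := prefixProd P k *ᵥ oneb (m + 1)

/-- Linear form whose values determine the sign in the `k`-th array of butterflies. -/
noncomputable def signForm {m : ℕ} (P : ℕ → Matrix (Fin (m + 1)) (Fin (m + 1)) (ZMod 2))
    (k : ℕ) : Fin (m + 1) → ZMod 2 := oneb (m + 1) ᵥ* (prefixProd P k)⁻¹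

lemma signForm_dotProduct_prefixProd {m : ℕ}
    {P : ℕ → Matrix (Fin (m + 1)) (Fin (m + 1)) (ZMod 2)} {k : ℕ}
    (h : IsUnit (prefixProd P k)) (v : Fin (m + 1) → ZMod 2) :
    signForm P k ⬝ᵥ (prefixProd P k *ᵥ v) = v (Fin.last m) := by
  rw [signForm, Matrix.dotProduct_mulVec, Matrix.vecMul_vecMul,
    Matrix.nonsing_inv_mul _ ((Matrix.isUnit_iff_isUnit_det _).1 h), Matrix.vecMul_one,
    oneb_succ, single_dotProduct, one_mul]

/-- Value of the `k`-th linear form before the `k`-th array of butterflies, along the path from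
`x` with choices `c`. -/
noncomputable def pathValue {m N : ℕ} (P : ℕ → Matrix (Fin (m + 1)) (Fin (m + 1)) (ZMod 2))
    (x : Fin (m + 1) → ZMod 2) (c : Fin N → ZMod 2) (k : ℕ) : ZMod 2 :=
  signForm P k ⬝ᵥ x + ∑ l : Fin N, if l.val < k then c l * (signForm P k ⬝ᵥ dirVec P l) else 0

/-- Entries of a product of arrays of butterflies and linear permutations as sums over paths. -/
lemma path_sum (m : ℕ) (P : ℕ → Matrix (Fin (m + 1)) (Fin (m + 1)) (ZMod 2)) (N : ℕ)
    (hP : ∀ k ≤ N, IsUnit (P k)) (j i : Fin (2 ^ (m + 1))) :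
    (permMat (m + 1) (P 0) *
      (List.ofFn fun k : Fin N => butterflies (m + 1) * permMat (m + 1) (P (k.val + 1))).prod) j i =
    ∑ c : Fin N → ZMod 2,
      if bits (m + 1) j + ∑ k, c k • dirVec P k = prefixProd P N *ᵥ bits (m + 1) i then
        signChar (∑ k : Fin N, pathValue P (bits (m + 1) j) c k *
          (pathValue P (bits (m + 1) j) c k + c k)) else 0 := by
  induction N generalizing i with
  | zero => simp [permMat, prefixProd, signChar]
  | succ N ih =>
    obtain ⟨i', hi'⟩ := (bits_bijective (m + 1)).2 (P (N + 1) *ᵥ bits (m + 1) i)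
    have hU : IsUnit (prefixProd P N) := isUnit_prefixProd fun l hl => hP l (by omega)
    rw [List.ofFn_succ', List.concat_eq_append, List.prod_append, List.prod_singleton,
      ← mul_assoc, ← mul_assoc, Fin.val_last, mul_permMat_apply _ _ _ _ i' hi', Matrix.mul_apply]
    simp only [Fin.val_castSucc]
    simp_rw [ih (fun k hk => hP k (by omega)), butterflies_apply, Finset.sum_mul_sum]
    rw [← (Fin.snocEquiv fun _ => ZMod 2).sum_comp, Fintype.sum_prod_type]
    simp_rw [Finset.sum_comm (s := (Finset.univ : Finset (Fin (2 ^ (m + 1)))))]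
    rw [Finset.sum_comm]
    refine Finset.sum_congr rfl fun a _ => Finset.sum_congr rfl fun c _ => ?_
    obtain ⟨i'', hi''⟩ := (bits_bijective (m + 1)).2 (bits (m + 1) i' + a • oneb (m + 1))
    have hcond : (bits (m + 1) j + ∑ k : Fin (N + 1),
          (Fin.snocEquiv fun _ => ZMod 2) (a, c) k • dirVec P k =
            prefixProd P (N + 1) *ᵥ bits (m + 1) i) ↔
        bits (m + 1) j + ∑ k : Fin N, c k • dirVec P k =
          prefixProd P N *ᵥ bits (m + 1) i'' := by
      rw [hi'', prefixProd, ← Matrix.mulVec_mulVec, ← hi', Matrix.mulVec_add, Matrix.mulVec_smul,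
        Fin.sum_univ_castSucc, ← add_assoc]
      simp only [Fin.snocEquiv_apply, Fin.snoc_castSucc, Fin.snoc_last, Fin.val_castSucc,
        Fin.val_last]
      rw [← eq_sub_iff_add_eq, sub_eq_add_neg, ← neg_smul, ZMod.neg_eq_self_mod_two]
      rfl
    rw [Finset.sum_eq_single i'']
    · rw [if_pos hi'']
      simp only [hcond]
      split_ifs with h
      · rw [← signChar_add, Fin.sum_univ_castSucc]
        have hpath : ∀ k : Fin N, pathValue P (bits (m + 1) j)
            ((Fin.snocEquiv fun _ => ZMod 2) (a, c)) k.castSucc =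
              pathValue P (bits (m + 1) j) c k := by
          intro k
          simp only [pathValue, Fin.sum_univ_castSucc, Fin.snocEquiv_apply, Fin.snoc_castSucc,
            Fin.snoc_last, Fin.val_castSucc, Fin.val_last]
          rw [if_neg (by omega), add_zero]
        have hlast : pathValue P (bits (m + 1) j) ((Fin.snocEquiv fun _ => ZMod 2) (a, c)) N =
            bits (m + 1) i'' (Fin.last m) := by
          rw [← signForm_dotProduct_prefixProd hU (bits (m + 1) i''), ← h]
          simp only [pathValue, Fin.sum_univ_castSucc, Fin.snocEquiv_apply, Fin.snoc_castSucc,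
            Fin.snoc_last, Fin.val_castSucc, Fin.val_last, lt_irrefl, if_false, add_zero,
            Fin.is_lt, if_true, dotProduct_add, dotProduct_sum, dotProduct_smul, smul_eq_mul]
        simp only [hpath, Fin.val_last, hlast]
        congr 2
        · simp only [Fin.snocEquiv_apply, Fin.snoc_castSucc]
        · simp only [hi'', Fin.snocEquiv_apply, Fin.snoc_last, oneb_succ, Pi.add_apply,
            Pi.smul_apply, Pi.single_eq_same, smul_eq_mul, mul_one]
          rw [add_assoc, CharTwo.add_self_eq_zero, add_zero]
      · simp
    · intro b _ hb
      rw [← hi'', if_neg fun h' => hb (bits_injective _ h'), mul_zero]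
    · simp

/-- A matrix supported on one side of the diagonal is determined by its quadratic form. -/
lemma eq_zero_of_quadratic {ι : Type*} [Fintype ι] [DecidableEq ι]
    (U : Matrix ι ι (ZMod 2)) (hU : ∀ k l, U k l ≠ 0 → U l k = 0)
    (h : ∀ a : ι → ZMod 2, (a + U *ᵥ a) ⬝ᵥ (U *ᵥ a) = 0) : U = 0 := by
  ext p q
  have h1 := h (Pi.single p 1 + Pi.single q 1)
  have hp := h (Pi.single p 1)
  have hq := h (Pi.single q 1)
  simp only [Matrix.mulVec_add, add_dotProduct, dotProduct_add] at h1 hp hq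
  rw [dotProduct_comm (U *ᵥ Pi.single q 1) (U *ᵥ Pi.single p 1)] at h1
  have hs : Pi.single p 1 ⬝ᵥ (U *ᵥ Pi.single q 1) + Pi.single q 1 ⬝ᵥ (U *ᵥ Pi.single p 1) = 0 := by
    linear_combination h1 - hp - hq -
      CharTwo.add_self_eq_zero ((U *ᵥ Pi.single p 1) ⬝ᵥ (U *ᵥ Pi.single q 1))
  simp only [single_dotProduct, one_mul, Matrix.mulVec_single_one, Matrix.col_apply] at hs
  by_contra hne
  rw [hU p q hne, add_zero] at hs
  exact hne hs

/-- The strictly lower triangular part of a matrix. -/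
def strictLower {n : ℕ} (D : Matrix (Fin n) (Fin n) (ZMod 2)) : Matrix (Fin n) (Fin n) (ZMod 2) :=
  Matrix.of fun k l => if l < k then D k l else 0

/-- The strictly upper triangular part of a matrix. -/
def strictUpper {n : ℕ} (D : Matrix (Fin n) (Fin n) (ZMod 2)) : Matrix (Fin n) (Fin n) (ZMod 2) :=
  Matrix.of fun k l => if k < l then D k l else 0

lemma eq_one_add_strictLower_add_strictUpper {n : ℕ} (D : Matrix (Fin n) (Fin n) (ZMod 2))
    (h : ∀ k, D k k = 1) : D = 1 + strictLower D + strictUpper D := by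
  ext k l
  rcases lt_trichotomy k l with hkl | rfl | hkl
  · simp [strictLower, strictUpper, hkl, hkl.not_gt, hkl.ne]
  · simp [strictLower, strictUpper, h]
  · simp [strictLower, strictUpper, hkl, hkl.not_gt, hkl.ne']

lemma strictLower_one {n : ℕ} : strictLower (1 : Matrix (Fin n) (Fin n) (ZMod 2)) = 0 := by
  ext k l
  simp only [strictLower, Matrix.of_apply, Matrix.zero_apply, ite_eq_right_iff]
  exact fun h => Matrix.one_apply_ne h.ne'

/-- Entries of `W(P)` as sums over paths, in matrix form. -/
lemma W_apply (m : ℕ) (P : ℕ → Matrix (Fin (m + 1)) (Fin (m + 1)) (ZMod 2))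
    (hP : ∀ k ≤ m + 1, IsUnit (P k)) (Φ X : Matrix (Fin (m + 1)) (Fin (m + 1)) (ZMod 2))
    (hΦ : ∀ k : Fin (m + 1), Φ k = signForm P k) (hX : ∀ k : Fin (m + 1), X.col k = dirVec P k)
    (j i : Fin (2 ^ (m + 1))) :
    W (m + 1) P j i = ∑ c : Fin (m + 1) → ZMod 2,
      if bits (m + 1) j + X *ᵥ c = prefixProd P (m + 1) *ᵥ bits (m + 1) i then
        signChar ((Φ *ᵥ bits (m + 1) j + strictLower (Φ * X) *ᵥ c) ⬝ᵥ
          (Φ *ᵥ bits (m + 1) j + strictLower (Φ * X) *ᵥ c + c)) else 0 := by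
  rw [W, path_sum m P (m + 1) hP]
  refine Finset.sum_congr rfl fun c _ => ?_
  have h1 : ∑ k, c k • dirVec P k = X *ᵥ c := by
    ext r
    simp only [Finset.sum_apply, Pi.smul_apply, ← hX, Matrix.mulVec, dotProduct, smul_eq_mul,
      Matrix.col_apply, mul_comm]
  have h2 : ∀ k : Fin (m + 1), pathValue P (bits (m + 1) j) c k =
      (Φ *ᵥ bits (m + 1) j + strictLower (Φ * X) *ᵥ c) k := by
    intro k
    rw [pathValue, Pi.add_apply, Matrix.mulVec, hΦ]
    congr 1
    refine Finset.sum_congr rfl fun l _ => ?_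
    simp only [strictLower, Matrix.of_apply, Fin.lt_def, ite_mul, zero_mul, Matrix.mul_apply']
    rw [hΦ, ← hX, mul_comm]
    rfl
  rw [h1]
  simp only [h2]
  rfl

lemma W_apply_of_path (m : ℕ) (P : ℕ → Matrix (Fin (m + 1)) (Fin (m + 1)) (ZMod 2))
    (hP : ∀ k ≤ m + 1, IsUnit (P k)) (Φ X : Matrix (Fin (m + 1)) (Fin (m + 1)) (ZMod 2))
    (hΦ : ∀ k : Fin (m + 1), Φ k = signForm P k) (hX : ∀ k : Fin (m + 1), X.col k = dirVec P k)
    (hXu : IsUnit X) (j i : Fin (2 ^ (m + 1))) (c : Fin (m + 1) → ZMod 2)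
    (hc : bits (m + 1) j + X *ᵥ c = prefixProd P (m + 1) *ᵥ bits (m + 1) i) :
    W (m + 1) P j i =
      signChar ((Φ *ᵥ bits (m + 1) j + strictLower (Φ * X) *ᵥ c) ⬝ᵥ
          (Φ *ᵥ bits (m + 1) j + strictLower (Φ * X) *ᵥ c + c)) := by
  rw [W_apply m P hP Φ X hΦ hX, Finset.sum_eq_single c, if_pos hc]
  · intro b _ hb
    rw [if_neg]
    intro h
    exact hb (Matrix.mulVec_injective_iff_isUnit.2 hXu (add_left_cancel (h.trans hc.symm)))
  · simp

theorem W_eq_hadamardH_iff (m : ℕ) (P : ℕ → Matrix (Fin (m + 1)) (Fin (m + 1)) (ZMod 2))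
    (hP : ∀ k ≤ m + 1, IsUnit (P k)) (Φ X : Matrix (Fin (m + 1)) (Fin (m + 1)) (ZMod 2))
    (hΦ : ∀ k : Fin (m + 1), Φ k = signForm P k) (hX : ∀ k : Fin (m + 1), X.col k = dirVec P k) :
    W (m + 1) P = hadamardH (m + 1) ↔ Φ * X = 1 ∧ prefixProd P (m + 1) = X * Xᵀ := by
  have hH : ∀ j i, hadamardH (m + 1) j i = signChar (bits (m + 1) j ⬝ᵥ bits (m + 1) i) :=
    fun j i => rfl
  have hA : IsUnit (prefixProd P (m + 1)) := isUnit_prefixProd hP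
  set A := prefixProd P (m + 1) with hAdef
  have hself : ∀ v : Fin (m + 1) → ZMod 2, v + v = 0 := fun v => CharTwo.add_self_eq_zero v
  constructor
  · intro hW
    have hXu : IsUnit X := by
      rw [← Matrix.mulVec_surjective_iff_isUnit]
      intro v
      obtain ⟨j, hj⟩ := (bits_bijective (m + 1)).2 v
      obtain ⟨i, hi⟩ := (bits_bijective (m + 1)).2 0
      have hne : W (m + 1) P j i ≠ 0 := by rw [hW, hH]; exact signChar_ne_zero _
      rw [W_apply m P hP Φ X hΦ hX] at hne
      obtain ⟨c, _, hc⟩ := Finset.exists_ne_zero_of_sum_ne_zero hne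
      refine ⟨c, ?_⟩
      have := (ite_ne_right_iff.1 hc).1
      rw [hi, hj, Matrix.mulVec_zero] at this
      rw [eq_comm, ← sub_eq_zero, sub_eq_add_neg, CharTwo.neg_eq, this]
    have hpath : ∀ x y c : Fin (m + 1) → ZMod 2, x + X *ᵥ c = A *ᵥ y →
        (Φ *ᵥ x + strictLower (Φ * X) *ᵥ c) ⬝ᵥ (Φ *ᵥ x + strictLower (Φ * X) *ᵥ c + c) =
          x ⬝ᵥ y := by
      intro x y c hc
      obtain ⟨j, rfl⟩ := (bits_bijective (m + 1)).2 x
      obtain ⟨i, rfl⟩ := (bits_bijective (m + 1)).2 y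
      apply signChar_injective
      rw [← hH, ← hW, W_apply_of_path m P hP Φ X hΦ hX hXu j i c hc]
    have hD : ∀ k, (Φ * X) k k = 1 := by
      intro k
      rw [Matrix.mul_apply', hΦ]
      change signForm P k ⬝ᵥ X.col k = 1
      rw [hX, dirVec, signForm_dotProduct_prefixProd, oneb_succ, Pi.single_eq_same]
      exact isUnit_prefixProd fun l hl => hP l (hl.trans k.2.le)
    have hdecomp := eq_one_add_strictLower_add_strictUpper (Φ * X) hD
    have hL : strictLower (Φ * X) = 0 := by
      apply eq_zero_of_quadratic
      · intro k l hkl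
        have : l < k := (ite_ne_right_iff.1 hkl).1
        exact if_neg this.not_gt
      · intro a
        obtain ⟨y, hy⟩ := Matrix.mulVec_surjective_iff_isUnit.2 hA (X *ᵥ a)
        have := hpath 0 y a (by rw [zero_add, hy])
        rw [Matrix.mulVec_zero, zero_add, zero_dotProduct] at this
        rw [dotProduct_comm, add_comm a, this]
    have hU : strictUpper (Φ * X) = 0 := by
      apply eq_zero_of_quadratic
      · intro k l hkl
        have : k < l := (ite_ne_right_iff.1 hkl).1
        exact if_neg this.not_gt
      · intro a
        have := hpath (X *ᵥ a) 0 a (by rw [hself, Matrix.mulVec_zero])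
        rw [Matrix.mulVec_mulVec, dotProduct_zero] at this
        rw [hL, add_zero] at hdecomp
        rw [hL, Matrix.zero_mulVec, add_zero] at this
        nth_rw 1 2 [hdecomp] at this
        rwa [Matrix.add_mulVec, Matrix.one_mulVec, add_right_comm, hself, zero_add] at this
    have hΦX : Φ * X = 1 := by rw [hdecomp, hL, hU, add_zero, add_zero]
    have hXΦ : X * Φ = 1 := mul_eq_one_comm.1 hΦX
    refine ⟨hΦX, ?_⟩
    have hform : Φᵀ * (Φ * A) = 1 := by
      apply Matrix.ext_of_mulVec_single
      intro q
      refine dotProduct_eq _ _ fun x => ?_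
      have := hpath x (Pi.single q 1) (Φ *ᵥ (x + A *ᵥ Pi.single q 1)) (by
        rw [Matrix.mulVec_mulVec, hXΦ, Matrix.one_mulVec, ← add_assoc, hself, zero_add])
      rw [hL, Matrix.zero_mulVec, add_zero, Matrix.mulVec_add, ← add_assoc, hself, zero_add] at this
      rw [Matrix.one_mulVec, dotProduct_comm _ x, dotProduct_comm _ x, ← this,
        ← Matrix.mulVec_mulVec, Matrix.dotProduct_mulVec, Matrix.vecMul_transpose,
        Matrix.mulVec_mulVec]
    calc A = X * (Φ * A) := by rw [← mul_assoc, hXΦ, one_mul]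
      _ = X * ((Φ * X)ᵀ * (Φ * A)) := by rw [hΦX, Matrix.transpose_one, one_mul]
      _ = X * Xᵀ * (Φᵀ * (Φ * A)) := by rw [Matrix.transpose_mul]; simp only [mul_assoc]
      _ = X * Xᵀ := by rw [hform, mul_one]
  · rintro ⟨hΦX, hAX⟩
    have hXΦ : X * Φ = 1 := mul_eq_one_comm.1 hΦX
    ext j i
    rw [W_apply_of_path m P hP Φ X hΦ hX (IsUnit.of_mul_eq_one _ hXΦ) j i
      (Φ *ᵥ (bits (m + 1) j + A *ᵥ bits (m + 1) i)), hH, hΦX, strictLower_one]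
    · congr 1
      rw [Matrix.zero_mulVec, add_zero, Matrix.mulVec_add, ← add_assoc, hself, zero_add,
        Matrix.mulVec_mulVec, hAX, ← mul_assoc, hΦX, one_mul, Matrix.dotProduct_mulVec,
        Matrix.vecMul_transpose, Matrix.mulVec_mulVec, hXΦ, Matrix.one_mulVec]
    · rw [Matrix.mulVec_mulVec, hXΦ, Matrix.one_mulVec, ← add_assoc, hself, zero_add]

lemma Cmat_pow_mulVec_oneb (m k : ℕ) (hk : k < m + 1) :
    Cmat (m + 1) ^ k *ᵥ oneb (m + 1) = Pi.single (Fin.rev ⟨k, hk⟩) 1 := by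
  induction k with
  | zero => rw [pow_zero, Matrix.one_mulVec, oneb_succ]; congr 1
  | succ k ih =>
    rw [pow_succ', ← Matrix.mulVec_mulVec, ih (by omega), Matrix.mulVec_single_one]
    ext r
    simp only [Matrix.col_apply, Cmat, Matrix.of_apply, Pi.single_apply, Fin.ext_iff, Fin.val_rev]
    exact if_congr (by omega) rfl rfl

lemma single_vecMul_Cmat_pow (m k : ℕ) (hk : k < m + 1) :
    Pi.single (Fin.rev ⟨k, hk⟩) 1 ᵥ* Cmat (m + 1) ^ k = oneb (m + 1) := by
  induction k with
  | zero => rw [pow_zero, Matrix.vecMul_one, oneb_succ]; congr 1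
  | succ k ih =>
    rw [pow_succ', ← Matrix.vecMul_vecMul, ← ih (by omega)]
    congr 1
    rw [Matrix.single_one_vecMul]
    ext r
    simp only [Matrix.row_apply, Cmat, Matrix.of_apply, Pi.single_apply, Fin.ext_iff, Fin.val_rev]
    exact if_congr (by omega) rfl rfl

lemma Cmat_pow_eq_one (m : ℕ) : Cmat (m + 1) ^ (m + 1) = 1 := by
  have h : Cmat (m + 1) ^ (m + 1) *ᵥ oneb (m + 1) = oneb (m + 1) := by
    rw [pow_succ', ← Matrix.mulVec_mulVec, Cmat_pow_mulVec_oneb m m (by omega),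
      Matrix.mulVec_single_one]
    ext r
    simp only [Matrix.col_apply, Cmat, Matrix.of_apply, oneb, Fin.val_rev]
    exact if_congr (by omega) rfl rfl
  apply Matrix.ext_of_mulVec_single
  intro i
  have hi := Cmat_pow_mulVec_oneb m i.rev i.rev.2
  rw [Fin.eta, Fin.rev_rev] at hi
  rw [← hi, Matrix.mulVec_mulVec, ← pow_add, add_comm (m + 1), pow_add, ← Matrix.mulVec_mulVec, h,
    Matrix.one_mulVec]

lemma isUnit_Cmat (m : ℕ) : IsUnit (Cmat (m + 1)) :=
  IsUnit.of_pow_eq_one (Cmat_pow_eq_one m) m.succ_ne_zero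

section DiagOne

variable {m : ℕ} (Q R : Matrix (Fin m) (Fin m) (ZMod 2))

lemma diagOne_castSucc_castSucc (k l : Fin m) : diagOne m Q k.castSucc l.castSucc = Q k l := by
  simp [diagOne, Fin.castSucc]

lemma diagOne_apply_last (k : Fin (m + 1)) : diagOne m Q k (Fin.last m) = oneb (m + 1) k := by
  rw [oneb_succ]
  induction k using Fin.lastCases with
  | last => simp [diagOne]
  | cast k =>
    rw [Pi.single_eq_of_ne (Fin.castSucc_lt_last k).ne]
    simp [diagOne, Fin.castSucc]

lemma diagOne_last_apply (k : Fin (m + 1)) : diagOne m Q (Fin.last m) k = oneb (m + 1) k := by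
  rw [oneb_succ]
  induction k using Fin.lastCases with
  | last => simp [diagOne]
  | cast k =>
    rw [Pi.single_eq_of_ne (Fin.castSucc_lt_last k).ne]
    simp [diagOne, Fin.castSucc]

lemma diagOne_mulVec_oneb : diagOne m Q *ᵥ oneb (m + 1) = oneb (m + 1) := by
  conv_lhs => rw [oneb_succ, Matrix.mulVec_single_one]
  ext k; exact diagOne_apply_last Q k

lemma oneb_vecMul_diagOne : oneb (m + 1) ᵥ* diagOne m Q = oneb (m + 1) := by
  conv_lhs => rw [oneb_succ, Matrix.single_one_vecMul]
  ext k; exact diagOne_last_apply Q k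

lemma diagOne_mul : diagOne m (Q * R) = diagOne m Q * diagOne m R := by
  simp [diagOne, Matrix.reindex_apply, Matrix.submatrix_mul_equiv, Matrix.fromBlocks_multiply]

lemma diagOne_one : diagOne m 1 = 1 := by
  simp [diagOne]

lemma det_diagOne : (diagOne m Q).det = Q.det := by
  simp [diagOne]

lemma isUnit_diagOne_iff : IsUnit (diagOne m Q) ↔ IsUnit Q := by
  rw [Matrix.isUnit_iff_isUnit_det, det_diagOne, ← Matrix.isUnit_iff_isUnit_det]

lemma diagOne_mul_inv (h : IsUnit Q) : diagOne m Q * diagOne m Q⁻¹ = 1 := by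
  rw [← diagOne_mul, Matrix.mul_nonsing_inv _ ((Matrix.isUnit_iff_isUnit_det _).1 h), diagOne_one]

lemma eq_diagOne {N : Matrix (Fin (m + 1)) (Fin (m + 1)) (ZMod 2)}
    (h1 : N *ᵥ oneb (m + 1) = oneb (m + 1)) (h2 : oneb (m + 1) ᵥ* N = oneb (m + 1)) :
    N = diagOne m (N.submatrix Fin.castSucc Fin.castSucc) := by
  ext k l
  induction l using Fin.lastCases with
  | last =>
    rw [diagOne_apply_last]
    nth_rw 1 [oneb_succ] at h1
    rw [Matrix.mulVec_single_one] at h1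
    exact congrFun h1 k
  | cast l =>
    induction k using Fin.lastCases with
    | last =>
      rw [diagOne_last_apply]
      nth_rw 1 [oneb_succ] at h2
      rw [Matrix.single_one_vecMul] at h2
      exact congrFun h2 _
    | cast k => rw [diagOne_castSucc_castSucc]; rfl

end DiagOne

/-- The matrix of linear forms attached to the arrays of butterflies. -/
noncomputable def formMatrix (m : ℕ) (P : ℕ → Matrix (Fin (m + 1)) (Fin (m + 1)) (ZMod 2)) :
    Matrix (Fin (m + 1)) (Fin (m + 1)) (ZMod 2) := Matrix.of fun k => signForm P k

/-- The matrix whose columns are the spreading directions. -/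
def dirMatrix (m : ℕ) (P : ℕ → Matrix (Fin (m + 1)) (Fin (m + 1)) (ZMod 2)) :
    Matrix (Fin (m + 1)) (Fin (m + 1)) (ZMod 2) := Matrix.of fun r k => dirVec P k r

/-- A sequence `P` factors through bit rotations if and only if its prefix products do. -/
lemma prefixProd_eq_iff (m : ℕ) (P : ℕ → Matrix (Fin (m + 1)) (Fin (m + 1)) (ZMod 2))
    (B : Matrix (Fin (m + 1)) (Fin (m + 1)) (ZMod 2)) (hB : IsUnit B)
    (Q : ℕ → Matrix (Fin m) (Fin m) (ZMod 2)) (hQ : ∀ k, 1 ≤ k → k ≤ m + 1 → IsUnit (Q k)) :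
    (P 0 = B * diagOne m (Q 1) ∧
      (∀ i, 0 < i → i < m + 1 →
        P i = diagOne m (Q i)⁻¹ * Cmat (m + 1) * diagOne m (Q (i + 1))) ∧
      P (m + 1) = diagOne m (Q (m + 1))⁻¹ * Cmat (m + 1) * Bᵀ) ↔
    (∀ k < m + 1, prefixProd P k = B * Cmat (m + 1) ^ k * diagOne m (Q (k + 1))) ∧
      prefixProd P (m + 1) = B * Bᵀ := by
  have hstep : ∀ k < m + 1, ∀ S T : Matrix (Fin (m + 1)) (Fin (m + 1)) (ZMod 2),
      S = diagOne m (Q (k + 1))⁻¹ * Cmat (m + 1) * T ↔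
      B * Cmat (m + 1) ^ k * diagOne m (Q (k + 1)) * S = B * Cmat (m + 1) ^ (k + 1) * T := by
    intro k hk S T
    have hQk := hQ (k + 1) (by omega) (by omega)
    have hu : IsUnit (B * Cmat (m + 1) ^ k * diagOne m (Q (k + 1))) :=
      (hB.mul ((isUnit_Cmat m).pow k)).mul ((isUnit_diagOne_iff _).2 hQk)
    have h : B * Cmat (m + 1) ^ (k + 1) * T = B * Cmat (m + 1) ^ k * diagOne m (Q (k + 1)) *
        (diagOne m (Q (k + 1))⁻¹ * Cmat (m + 1) * T) := by
      rw [pow_succ]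
      simp only [mul_assoc]
      rw [← mul_assoc (diagOne m (Q (k + 1))), diagOne_mul_inv _ hQk, one_mul]
    rw [h, hu.mul_right_inj]
  have hlast : B * Cmat (m + 1) ^ (m + 1) * Bᵀ = B * Bᵀ := by
    rw [Cmat_pow_eq_one, mul_one]
  constructor
  · rintro ⟨h0, h1, h2⟩
    have h : ∀ k < m + 1, prefixProd P k = B * Cmat (m + 1) ^ k * diagOne m (Q (k + 1)) := by
      intro k
      induction k with
      | zero => intro _; rw [prefixProd, h0, pow_zero, mul_one]
      | succ k ih =>
        intro hk
        rw [prefixProd, ih (by omega)]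
        exact (hstep k (by omega) _ _).1 (h1 (k + 1) (by omega) hk)
    refine ⟨h, ?_⟩
    rw [prefixProd, h m (by omega), (hstep m (by omega) _ _).1 h2, hlast]
  · rintro ⟨h, hA⟩
    refine ⟨by simpa [prefixProd] using h 0 (by omega), ?_, ?_⟩
    · rintro (_ | i) hi hi'
      · omega
      · rw [hstep i (by omega), ← h i (by omega), ← h (i + 1) hi']
        rfl
    · rw [hstep m (by omega), ← h m (by omega), hlast, ← hA]
      rfl

/-- Enumeration corollary: for `n = m + 1 ≥ 1`, `W(P) = H_n` iff there exist
`B ∈ GL_n(F_2)` and `Q_1, ..., Q_n ∈ GL_{n-1}(F_2)` with `P_0 = B·diag(Q_1,1)`,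
`P_i = diag(Q_i⁻¹,1)·C_n·diag(Q_{i+1},1)` for `0 < i < n`, and
`P_n = diag(Q_n⁻¹,1)·C_n·Bᵀ`. -/
theorem enumeration (m : ℕ) (P : ℕ → Matrix (Fin (m + 1)) (Fin (m + 1)) (ZMod 2))
    (hP : ∀ k ≤ m + 1, IsUnit (P k)) :
    W (m + 1) P = hadamardH (m + 1) ↔
      ∃ (B : Matrix (Fin (m + 1)) (Fin (m + 1)) (ZMod 2))
        (Q : ℕ → Matrix (Fin m) (Fin m) (ZMod 2)),
        IsUnit B ∧ (∀ k, 1 ≤ k → k ≤ m + 1 → IsUnit (Q k)) ∧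
        P 0 = B * diagOne m (Q 1) ∧
        (∀ i, 0 < i → i < m + 1 →
          P i = diagOne m (Q i)⁻¹ * Cmat (m + 1) * diagOne m (Q (i + 1))) ∧
        P (m + 1) = diagOne m (Q (m + 1))⁻¹ * Cmat (m + 1) * Bᵀ := by
  rw [W_eq_hadamardH_iff m P hP (formMatrix m P) (dirMatrix m P) (fun _ => rfl) (fun _ => rfl)]
  have hG : ∀ k < m + 1, IsUnit (prefixProd P k) := fun k hk =>
    isUnit_prefixProd fun l hl => hP l (by omega)
  let J : Fin (m + 1) ≃ Fin (m + 1) := Fin.revPerm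
  constructor
  · rintro ⟨hΦX, hA⟩
    set B := (dirMatrix m P).submatrix id J with hBdef
    have hΦB : ∀ k (hk : k < m + 1), signForm P k ᵥ* B = Pi.single (Fin.rev ⟨k, hk⟩) 1 := by
      intro k hk
      ext r
      have := congrFun (congrFun hΦX ⟨k, hk⟩) r.rev
      rw [Matrix.one_apply, Matrix.mul_apply'] at this
      rw [Pi.single_apply]
      refine this.trans (if_congr ?_ rfl rfl)
      rw [eq_comm, Fin.rev_eq_iff]
    have hBB : B * Bᵀ = prefixProd P (m + 1) := by
      rw [hA, hBdef, Matrix.transpose_submatrix, Matrix.submatrix_mul_equiv,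
        Matrix.submatrix_id_id]
    have hB : IsUnit B := (Matrix.isUnit_submatrix_equiv (Equiv.refl _) J).2
      (IsUnit.of_mul_eq_one _ (mul_eq_one_comm.1 hΦX))
    have hM : ∀ k, IsUnit (B * Cmat (m + 1) ^ k) := fun k => hB.mul ((isUnit_Cmat m).pow k)
    let N : ℕ → Matrix (Fin (m + 1)) (Fin (m + 1)) (ZMod 2) := fun k =>
      (B * Cmat (m + 1) ^ k)⁻¹ * prefixProd P k
    have hMN : ∀ k, B * Cmat (m + 1) ^ k * N k = prefixProd P k := fun k =>
      Matrix.mul_nonsing_inv_cancel_left _ _ ((Matrix.isUnit_iff_isUnit_det _).1 (hM k))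
    have hN : ∀ k < m + 1, N k = diagOne m ((N k).submatrix Fin.castSucc Fin.castSucc) := by
      intro k hk
      apply eq_diagOne
      · apply Matrix.mulVec_injective_iff_isUnit.2 (hM k)
        change (B * Cmat (m + 1) ^ k) *ᵥ N k *ᵥ oneb (m + 1) =
          (B * Cmat (m + 1) ^ k) *ᵥ oneb (m + 1)
        rw [Matrix.mulVec_mulVec, hMN, ← Matrix.mulVec_mulVec, Cmat_pow_mulVec_oneb m k hk,
          Matrix.mulVec_single_one]
        ext r
        simp [hBdef, J, dirMatrix, dirVec]
      · have h : signForm P k ᵥ* (B * Cmat (m + 1) ^ k) = oneb (m + 1) := by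
          rw [← Matrix.vecMul_vecMul, hΦB k hk, single_vecMul_Cmat_pow]
        nth_rw 1 [← h]
        rw [Matrix.vecMul_vecMul, hMN, signForm, Matrix.vecMul_vecMul,
          Matrix.nonsing_inv_mul _ ((Matrix.isUnit_iff_isUnit_det _).1 (hG k hk)),
          Matrix.vecMul_one]
    let Q : ℕ → Matrix (Fin m) (Fin m) (ZMod 2) := fun k =>
      (N (k - 1)).submatrix Fin.castSucc Fin.castSucc
    have hQ : ∀ k, 1 ≤ k → k ≤ m + 1 → IsUnit (Q k) := by
      intro k hk hk'
      rw [← isUnit_diagOne_iff, ← hN (k - 1) (by omega)]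
      exact (Matrix.isUnit_nonsing_inv_iff.2 (hM _)).mul (hG _ (by omega))
    refine ⟨B, Q, hB, hQ, (prefixProd_eq_iff m P B hB Q hQ).2 ⟨fun k hk => ?_, hBB.symm⟩⟩
    rw [← hMN]
    congr 1
    exact hN k hk
  · rintro ⟨B, Q, hB, hQ, h⟩
    obtain ⟨h, hA⟩ := (prefixProd_eq_iff m P B hB Q hQ).1 h
    have hX : dirMatrix m P = B.submatrix id J := by
      ext r k
      change (prefixProd P k *ᵥ oneb (m + 1)) r = _
      rw [h k k.2, ← Matrix.mulVec_mulVec, diagOne_mulVec_oneb, ← Matrix.mulVec_mulVec,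
        Cmat_pow_mulVec_oneb m k k.2, Matrix.mulVec_single_one]
      rfl
    have hΦB : ∀ k : Fin (m + 1), signForm P k ᵥ* B = Pi.single k.rev 1 := by
      intro k
      have hdet := (Matrix.isUnit_iff_isUnit_det _).1 (hG k k.2)
      have hBdet := (Matrix.isUnit_iff_isUnit_det _).1 hB
      have hk : Pi.single k.rev 1 ᵥ* (B⁻¹ * prefixProd P k) = oneb (m + 1) := by
        rw [h k k.2, mul_assoc B, Matrix.nonsing_inv_mul_cancel_left _ _ hBdet,
          ← Matrix.vecMul_vecMul, single_vecMul_Cmat_pow m k k.2, oneb_vecMul_diagOne]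
      rw [signForm, ← hk, Matrix.vecMul_vecMul, Matrix.vecMul_vecMul,
        mul_assoc, Matrix.mul_nonsing_inv_cancel_left _ _ hdet, Matrix.nonsing_inv_mul _ hBdet,
        Matrix.vecMul_one]
    constructor
    · ext k l
      rw [hX, Matrix.one_apply]
      refine (congrFun (hΦB k) l.rev).trans ?_
      rw [Pi.single_apply]
      exact if_congr (by rw [Fin.rev_inj, eq_comm]) rfl rfl
    · rw [hA, hX, Matrix.transpose_submatrix, Matrix.submatrix_mul_equiv, Matrix.submatrix_id_id]
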